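/- Let G be a binary SSG (every vertex of V_MAX has outdegree exactly 2). If σ and σ' are MAX strategies with S_σ ⊊ S_{σ'} (strict inclusion of switch sets), then v_σ > v_{σ'}. -/

import Mathlib

open scoped BigOperators

instance : Fact ((0:ℝ) ≤ 1) := ⟨zero_le_one⟩

/-- A simple stochastic game on a finite vertex set `V`. -/
structure SSG (V : Type*) [Fintype V] [DecidableEq V] where
  /-- MAX vertices -/
  VMax : Finset V
  /-- MIN vertices -/
  VMin : Finset V
  /-- random vertices -/
  VR : Finset V
  /-- sink vertices -/
  VS : Finset V
  cover : ∀ x : V, x ∈ VMax ∨ x ∈ VMin ∨ x ∈ VR ∨ x ∈ VS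
  disjMaxMin : Disjoint VMax VMin
  disjMaxR : Disjoint VMax VR
  disjMaxS : Disjoint VMax VS
  disjMinR : Disjoint VMin VR
  disjMinS : Disjoint VMin VS
  disjRS : Disjoint VR VS
  /-- out-neighbourhood: `y ∈ succ x` iff `(x,y)` is an edge -/
  succ : V → Finset V
  outMax : ∀ x ∈ VMax, 2 ≤ (succ x).card
  outMin : ∀ x ∈ VMin, 2 ≤ (succ x).card
  outR : ∀ x ∈ VR, 1 ≤ (succ x).card
  /-- transition probabilities at random vertices -/
  prob : V → V → ℝ
  prob_nonneg : ∀ x y, 0 ≤ prob x y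
  prob_support : ∀ x ∈ VR, ∀ y, y ∉ succ x → prob x y = 0
  prob_sum : ∀ x ∈ VR, (∑ y, prob x y) = 1
  /-- values of the sinks -/
  val : V → ℝ
  val_mem : ∀ x ∈ VS, val x ∈ Set.Icc (0:ℝ) 1

namespace SSG

variable {V : Type*} [Fintype V] [DecidableEq V]

/-- A positional MAX strategy: a choice of an out-neighbour at every MAX vertex
(normalised to the identity away from `VMax`). -/
structure MaxStrategy (G : SSG V) where
  toFun : V → V
  mem_succ : ∀ x ∈ G.VMax, toFun x ∈ G.succ x
  eq_id : ∀ x ∉ G.VMax, toFun x = x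

/-- A positional MIN strategy. -/
structure MinStrategy (G : SSG V) where
  toFun : V → V
  mem_succ : ∀ x ∈ G.VMin, toFun x ∈ G.succ x
  eq_id : ∀ x ∉ G.VMin, toFun x = x

/-- The one-step (monotone) operator on value vectors associated with `(σ,τ)`. -/
noncomputable def F (G : SSG V) (σ : G.MaxStrategy) (τ : G.MinStrategy)
    (w : V → unitInterval) (x : V) : unitInterval :=
  if _hM : x ∈ G.VMax then w (σ.toFun x)
  else if _hN : x ∈ G.VMin then w (τ.toFun x)
  else if hR : x ∈ G.VR then
    ⟨∑ y, G.prob x y * (w y : ℝ), by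
      constructor
      · exact Finset.sum_nonneg fun y _ =>
          mul_nonneg (G.prob_nonneg x y) (w y).2.1
      · calc (∑ y, G.prob x y * (w y : ℝ)) ≤ ∑ y, G.prob x y :=
              Finset.sum_le_sum fun y _ =>
                mul_le_of_le_one_right (G.prob_nonneg x y) (w y).2.2
          _ = 1 := G.prob_sum x hR⟩
  else ⟨G.val x, G.val_mem x (by
    rcases G.cover x with h | h | h | h
    · exact absurd h _hM
    · exact absurd h _hN
    · exact absurd h hR
    · exact h)⟩

/-- The value vector `v_{σ,τ}`: the least fixed point (à la Knaster–Tarski) of `F`. -/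
noncomputable def value (G : SSG V) (σ : G.MaxStrategy) (τ : G.MinStrategy) :
    V → unitInterval :=
  sInf {w : V → unitInterval | G.F σ τ w ≤ w}

/-- `τ` is a best response to `σ`. -/
def IsBestResponse (G : SSG V) (σ : G.MaxStrategy) (τ : G.MinStrategy) : Prop :=
  ∀ τ' : G.MinStrategy, G.value σ τ ≤ G.value σ τ'

/-- `σ` is an optimal MAX strategy: `v_σ ≥ v_{σ'}` for every MAX strategy `σ'`
(values being computed against best responses). -/
def IsOptimal (G : SSG V) (σ : G.MaxStrategy) : Prop :=
  ∀ τ : G.MinStrategy, G.IsBestResponse σ τ →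
    ∀ σ' : G.MaxStrategy, ∀ τ' : G.MinStrategy, G.IsBestResponse σ' τ' →
      G.value σ' τ' ≤ G.value σ τ

/-- The switch set `S_σ` of `σ`, computed with a best response `τ` to `σ`. -/
def switchSet (G : SSG V) (σ : G.MaxStrategy) (τ : G.MinStrategy) : Set V :=
  {x | x ∈ G.VMax ∧ ∃ y ∈ G.succ x, G.value σ τ x < G.value σ τ y}

/-- `σ'` is a `σ`-switch (w.r.t. a best response `τ` to `σ`). -/
def IsSwitch (G : SSG V) (σ : G.MaxStrategy) (τ : G.MinStrategy)
    (σ' : G.MaxStrategy) : Prop :=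
  σ' ≠ σ ∧
  (∀ x ∈ G.VMax, x ∉ G.switchSet σ τ → σ'.toFun x = σ.toFun x) ∧
  (∀ x ∈ G.switchSet σ τ, σ'.toFun x ≠ σ.toFun x →
    G.value σ τ x < G.value σ τ (σ'.toFun x))

/-- `σ` agrees with `σ₀` on `T`. -/
def AgreesOn (G : SSG V) (T : Set V) (σ₀ σ : G.MaxStrategy) : Prop :=
  ∀ x ∈ T, σ.toFun x = σ₀.toFun x

/-- `σ` is an optimal MAX strategy of the subgame `G_{|T[σ₀]}`: it agrees with `σ₀` on `T`
and its value vector dominates that of every MAX strategy of `G` agreeing with `σ₀` on `T`. -/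
def IsOptimalOn (G : SSG V) (T : Set V) (σ₀ σ : G.MaxStrategy) : Prop :=
  G.AgreesOn T σ₀ σ ∧
  ∀ σ' : G.MaxStrategy, G.AgreesOn T σ₀ σ' →
    ∀ τ τ' : G.MinStrategy, G.IsBestResponse σ τ → G.IsBestResponse σ' τ' →
      G.value σ' τ' ≤ G.value σ τ

/-- `σ'` is a `(σ,T)`-super-switch (w.r.t. a best response `τ` to `σ`): it is obtained from an
intermediate `σ`-switch `σ''` that only switches inside `T`, by taking an optimal strategy of
the subgame `G_{|T[σ'']}`. -/
def IsSuperSwitch (G : SSG V) (σ : G.MaxStrategy) (τ : G.MinStrategy)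
    (T : Set V) (σ' : G.MaxStrategy) : Prop :=
  ∃ σ'' : G.MaxStrategy, G.IsSwitch σ τ σ'' ∧
    (∀ x ∈ G.VMax, x ∉ T → σ''.toFun x = σ.toFun x) ∧
    G.IsOptimalOn T σ'' σ'

/-- A binary SSG: every MAX vertex has outdegree exactly 2. -/
def Binary (G : SSG V) : Prop := ∀ x ∈ G.VMax, (G.succ x).card = 2

/-- `σb` is the total switch `σ̄` of `σ` (in a binary SSG): it switches to the other
out-neighbour exactly on the switch set of `σ`. -/
def IsTotalSwitch (G : SSG V) (σ : G.MaxStrategy) (τ : G.MinStrategy)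
    (σb : G.MaxStrategy) : Prop :=
  (∀ x ∈ G.switchSet σ τ, σb.toFun x ≠ σ.toFun x) ∧
  (∀ x ∈ G.VMax, x ∉ G.switchSet σ τ → σb.toFun x = σ.toFun x)

end SSG

namespace SSG

variable {V : Type*} [Fintype V] [DecidableEq V]

theorem F_mono (G : SSG V) (σ : G.MaxStrategy) (τ : G.MinStrategy) :
    Monotone (G.F σ τ) := by
  intro w w' h x
  unfold F
  split_ifs with h1 h2 h3
  · exact h _
  · exact h _
  · exact Subtype.mk_le_mk.2 (Finset.sum_le_sum fun y _ =>
      mul_le_mul_of_nonneg_left (h y) (G.prob_nonneg x y))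
  · exact le_rfl

theorem value_fixed (G : SSG V) (σ : G.MaxStrategy) (τ : G.MinStrategy) :
    G.F σ τ (G.value σ τ) = G.value σ τ :=
  OrderHom.map_lfp (⟨G.F σ τ, G.F_mono σ τ⟩ : (V → unitInterval) →o (V → unitInterval))

theorem value_le (G : SSG V) (σ : G.MaxStrategy) (τ : G.MinStrategy)
    {w : V → unitInterval} (h : G.F σ τ w ≤ w) : G.value σ τ ≤ w :=
  sInf_le h

theorem F_max (G : SSG V) (σ : G.MaxStrategy) (τ : G.MinStrategy) (w : V → unitInterval)
    {x : V} (h : x ∈ G.VMax) : G.F σ τ w x = w (σ.toFun x) := by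
  simp [F, h]

theorem F_min (G : SSG V) (σ : G.MaxStrategy) (τ : G.MinStrategy) (w : V → unitInterval)
    {x : V} (h : x ∈ G.VMin) : G.F σ τ w x = w (τ.toFun x) := by
  have h1 : x ∉ G.VMax := Finset.disjoint_right.1 G.disjMaxMin h
  simp [F, h, h1]

theorem F_rand (G : SSG V) (σ : G.MaxStrategy) (τ : G.MinStrategy) (w : V → unitInterval)
    {x : V} (h : x ∈ G.VR) : (G.F σ τ w x : ℝ) = ∑ y, G.prob x y * (w y : ℝ) := by
  have h1 : x ∉ G.VMax := Finset.disjoint_right.1 G.disjMaxR h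
  have h2 : x ∉ G.VMin := Finset.disjoint_right.1 G.disjMinR h
  simp [F, h, h1, h2]

theorem F_sink (G : SSG V) (σ : G.MaxStrategy) (τ : G.MinStrategy) (w : V → unitInterval)
    {x : V} (h : x ∈ G.VS) : (G.F σ τ w x : ℝ) = G.val x := by
  have h1 : x ∉ G.VMax := Finset.disjoint_right.1 G.disjMaxS h
  have h2 : x ∉ G.VMin := Finset.disjoint_right.1 G.disjMinS h
  have h3 : x ∉ G.VR := Finset.disjoint_right.1 G.disjRS h
  simp [F, h1, h2, h3]

theorem value_max (G : SSG V) (σ : G.MaxStrategy) (τ : G.MinStrategy)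
    {x : V} (h : x ∈ G.VMax) : G.value σ τ x = G.value σ τ (σ.toFun x) := by
  rw [← G.F_max σ τ (G.value σ τ) h, G.value_fixed]

theorem value_min (G : SSG V) (σ : G.MaxStrategy) (τ : G.MinStrategy)
    {x : V} (h : x ∈ G.VMin) : G.value σ τ x = G.value σ τ (τ.toFun x) := by
  rw [← G.F_min σ τ (G.value σ τ) h, G.value_fixed]

theorem value_rand (G : SSG V) (σ : G.MaxStrategy) (τ : G.MinStrategy)
    {x : V} (h : x ∈ G.VR) :
    (G.value σ τ x : ℝ) = ∑ y, G.prob x y * (G.value σ τ y : ℝ) := by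
  rw [← G.F_rand σ τ _ h, G.value_fixed]

theorem value_sink (G : SSG V) (σ : G.MaxStrategy) (τ : G.MinStrategy)
    {x : V} (h : x ∈ G.VS) : (G.value σ τ x : ℝ) = G.val x := by
  rw [← G.F_sink σ τ (G.value σ τ) h, G.value_fixed]

/-- At a MIN vertex the value under a best response is at most that of any out-neighbour. -/
theorem IsBestResponse.le_succ {G : SSG V} {σ : G.MaxStrategy} {τ : G.MinStrategy}
    (hbr : G.IsBestResponse σ τ) {x y : V} (hx : x ∈ G.VMin) (hy : y ∈ G.succ x) :
    G.value σ τ x ≤ G.value σ τ y := by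
  by_contra hlt
  rw [not_le] at hlt
  let ρ : G.MinStrategy :=
    { toFun := Function.update τ.toFun x y
      mem_succ := by
        intro z hz
        by_cases hzx : z = x
        · subst hzx; simpa using hy
        · simpa [hzx] using τ.mem_succ z hz
      eq_id := by
        intro z hz
        have hzx : z ≠ x := by rintro rfl; exact hz hx
        simpa [hzx] using τ.eq_id z hz }
  have hle : G.value σ ρ ≤ G.value σ τ := by
    apply G.value_le
    intro z
    by_cases hzx : z = x
    · subst hzx
      rw [G.F_min σ ρ _ hx]
      simpa [ρ] using hlt.le
    · have : G.F σ ρ (G.value σ τ) z = G.F σ τ (G.value σ τ) z := by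
        simp [F, ρ, hzx]
      rw [this, G.value_fixed]
  have h1 : G.value σ ρ x = G.value σ ρ y := by
    rw [G.value_min σ ρ hx]; simp [ρ]
  have h2 := hbr ρ x
  rw [h1] at h2
  exact absurd (h2.trans (hle y)) (not_le.2 hlt)

/-- A set without sinks that is closed under the moves of `(σ,τ)` has value zero. -/
theorem value_zero_of_closed (G : SSG V) (σ : G.MaxStrategy) (τ : G.MinStrategy) (A : Set V)
    (hmax : ∀ x ∈ A, x ∈ G.VMax → σ.toFun x ∈ A)
    (hmin : ∀ x ∈ A, x ∈ G.VMin → τ.toFun x ∈ A)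
    (hrand : ∀ x ∈ A, x ∈ G.VR → ∀ y, G.prob x y ≠ 0 → y ∈ A)
    (hsink : ∀ x ∈ A, x ∉ G.VS) {x : V} (hx : x ∈ A) : G.value σ τ x = 0 := by
  classical
  let w : V → unitInterval := fun z => if z ∈ A then 0 else G.value σ τ z
  have hw : ∀ z ∈ A, w z = 0 := fun z hz => by simp [w, hz]
  have hwle : w ≤ G.value σ τ := by
    intro z
    by_cases hz : z ∈ A
    · rw [hw z hz]; exact (G.value σ τ z).2.1
    · simp [w, hz]
  have hpre : G.F σ τ w ≤ w := by
    intro z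
    by_cases hz : z ∈ A
    · rw [hw z hz]
      rcases G.cover z with h | h | h | h
      · rw [G.F_max σ τ _ h, hw _ (hmax z hz h)]
      · rw [G.F_min σ τ _ h, hw _ (hmin z hz h)]
      · apply le_of_eq
        apply Subtype.ext
        rw [G.F_rand σ τ _ h]
        apply Finset.sum_eq_zero
        intro y _
        by_cases hp : G.prob z y = 0
        · simp [hp]
        · simp [hw y (hrand z hz h y hp)]
      · exact absurd h (hsink z hz)
    · have h1 : w z = G.value σ τ z := by simp [w, hz]
      rw [h1]
      calc G.F σ τ w z ≤ G.F σ τ (G.value σ τ) z := G.F_mono σ τ hwle z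
        _ = G.value σ τ z := by rw [G.value_fixed]
  have := G.value_le σ τ hpre x
  rw [hw x hx] at this
  exact le_antisymm this (G.value σ τ x).2.1

theorem value_le_of_switchSet_subset (G : SSG V)
    (hbin : G.Binary) (σ σ' : G.MaxStrategy) (τ τ' : G.MinStrategy)
    (hbr' : G.IsBestResponse σ' τ')
    (hss : G.switchSet σ τ ⊆ G.switchSet σ' τ') :
    G.value σ' τ' ≤ G.value σ τ := by
  intro x₀
  set v := G.value σ τ with hv
  set v' := G.value σ' τ' with hv'
  obtain ⟨m, -, hm⟩ := Finset.exists_max_image Finset.univ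
    (fun x => (v' x : ℝ) - v x) ⟨x₀, Finset.mem_univ _⟩
  have hm : ∀ y, (v' y : ℝ) - v y ≤ v' m - v m := fun y => hm y (Finset.mem_univ _)
  by_contra hcon
  have hcon : (v x₀ : ℝ) < v' x₀ := not_le.1 hcon
  have hpos : (0 : ℝ) < v' m - v m := by linarith [hm x₀]
  have hzero : G.value σ' τ m = 0 := by
    apply G.value_zero_of_closed σ' τ {x | (v' x : ℝ) - v x = v' m - v m} _ _ _ _ rfl
    · intro x (hx : _ = _) hM
      change _ = _
      by_cases hS : x ∈ G.switchSet σ' τ'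
      · obtain ⟨_, y, hy, hlt⟩ := hS
        have hvx : v' x = v' (σ'.toFun x) := G.value_max σ' τ' hM
        have hvx2 : v x = v (σ.toFun x) := G.value_max σ τ hM
        have hne : y ≠ σ'.toFun x := by
          rintro rfl
          exact absurd hvx hlt.ne
        have hσ : σ.toFun x = σ'.toFun x ∨ σ.toFun x = y := by
          have hsub : ({σ'.toFun x, y} : Finset V) = G.succ x := by
            apply Finset.eq_of_subset_of_card_le
            · intro z hz
              rcases Finset.mem_insert.1 hz with rfl | hz
              · exact σ'.mem_succ x hM
              · rw [Finset.mem_singleton.1 hz]; exact hy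
            · rw [hbin x hM, Finset.card_pair hne.symm]
          have := σ.mem_succ x hM
          rw [← hsub] at this
          simpa using this
        rcases hσ with h | h
        · rw [← h] at hvx ⊢
          rw [← hvx, ← hvx2]; exact hx
        · exfalso
          rw [h] at hvx2
          have h1 : (v' x : ℝ) < v' y := hlt
          have h2 := hm y
          rw [← hvx2] at h2
          linarith
      · have hS2 : x ∉ G.switchSet σ τ := fun h => hS (hss h)
        have h1 : (v (σ'.toFun x) : ℝ) ≤ v x := by
          by_contra h
          exact hS2 ⟨hM, _, σ'.mem_succ x hM, not_le.1 h⟩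
        have hvx : v' x = v' (σ'.toFun x) := G.value_max σ' τ' hM
        have h2 := hm (σ'.toFun x)
        rw [← hvx] at h2 ⊢
        linarith
    · intro x (hx : _ = _) hN
      change _ = _
      have h1 : v x = v (τ.toFun x) := G.value_min σ τ hN
      have h2 : (v' x : ℝ) ≤ v' (τ.toFun x) := hbr'.le_succ hN (τ.mem_succ x hN)
      have h3 := hm (τ.toFun x)
      rw [← h1] at h3 ⊢
      linarith
    · intro x (hx : _ = _) hR y hp
      change _ = _
      have h1 : (v x : ℝ) = _ := G.value_rand σ τ hR
      have h2 : (v' x : ℝ) = _ := G.value_rand σ' τ' hR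
      have hsum : ∑ z, G.prob x z * ((v' m - v m) - ((v' z : ℝ) - v z)) = 0 := by
        simp only [mul_sub, Finset.sum_sub_distrib, ← Finset.sum_mul, G.prob_sum x hR]
        rw [← hv] at h1
        rw [← hv'] at h2
        rw [← h1, ← h2]
        linarith
      have h3 := (Finset.sum_eq_zero_iff_of_nonneg (fun z _ =>
        mul_nonneg (G.prob_nonneg x z) (sub_nonneg.2 (hm z)))).1 hsum y (Finset.mem_univ _)
      rcases mul_eq_zero.1 h3 with h | h
      · exact absurd h hp
      · linarith
    · intro x (hx : _ = _) hS
      have h1 : (v x : ℝ) = _ := G.value_sink σ τ hS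
      have h2 : (v' x : ℝ) = _ := G.value_sink σ' τ' hS
      linarith
  have h1 : (v' m : ℝ) ≤ G.value σ' τ m := hbr' τ m
  rw [hzero] at h1
  have h2 : (0 : ℝ) ≤ v m := (v m).2.1
  have h3 : ((0 : unitInterval) : ℝ) = 0 := rfl
  linarith

end SSG

/-- in a binary SSG, strict inclusion of switch sets `S_σ ⊊ S_{σ'}` implies
`v_σ > v_{σ'}`. -/
theorem value_gt_of_switchSet_ssubset {V : Type*} [Fintype V] [DecidableEq V] (G : SSG V)
    (hbin : G.Binary) (σ σ' : G.MaxStrategy) (τ τ' : G.MinStrategy)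
    (hbr : G.IsBestResponse σ τ) (hbr' : G.IsBestResponse σ' τ')
    (hss : G.switchSet σ τ ⊂ G.switchSet σ' τ') :
    G.value σ' τ' < G.value σ τ := by
  refine lt_of_le_of_ne (G.value_le_of_switchSet_subset hbin σ σ' τ τ' hbr' hss.1) ?_
  intro h
  apply hss.2
  unfold SSG.switchSet
  rw [h]
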